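/- arXiv:2204.01310 — 3 statements merged into one kernel-verified Lean document; each statement's English description precedes it below -/
import Mathlib

section
/- Let (W,S) be a Coxeter system and let I, J ⊆ S be such that the parabolic subgroup W_{I∪J} is finite (so in particular W_I and W_J are finite). Then the join of w0(I) and w0(J) in the left weak order on W exists and equals w0(I∪J). -/
open Polynomial

namespace CoxeterCharPoly

variable {B W : Type*} [Group W] {M : CoxeterMatrix B}

/-- The left weak order on a Coxeter group. -/
def wle (cs : CoxeterSystem M W) (u w : W) : Prop :=
  cs.length w = cs.length (w * u⁻¹) + cs.length u

/-- The standard parabolic subgroup generated by `J ⊆ S`. -/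
def parabolic (cs : CoxeterSystem M W) (J : Set B) : Subgroup W :=
  Subgroup.closure (cs.simple '' J)

/- The longest element of the parabolic subgroup `W_J` (junk value if there is
no element of maximal length). -/
open Classical in
noncomputable def w0 (cs : CoxeterSystem M W) (J : Set B) : W :=
  if h : ∃ w ∈ parabolic cs J, ∀ u ∈ parabolic cs J, cs.length u ≤ cs.length w
  then h.choose else 1

section InversionParity

theorem functionEnd_mul_apply {α : Type*} (f g : Function.End α) (x : α) :
    (f * g) x = f (g x) := rfl

theorem functionEnd_one_apply {α : Type*} (x : α) : (1 : Function.End α) x = x := rfl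

open Classical in
/-- The action of a simple reflection `s` on `W × ZMod 2`: conjugate the first coordinate by `s`,
and flip the second one exactly when the first one is `s`. -/
noncomputable def signedConj (cs : CoxeterSystem M W) (i : B) : Function.End (W × ZMod 2) :=
  fun p ↦ (cs.simple i * p.1 * cs.simple i, p.2 + if p.1 = cs.simple i then 1 else 0)

open Classical in
theorem signedConj_mul_pow_apply (cs : CoxeterSystem M W) (i j : B) (n : ℕ) (p : W × ZMod 2) :
    ((signedConj cs i * signedConj cs j) ^ n) p =
      ((cs.simple i * cs.simple j) ^ n * p.1 * ((cs.simple i * cs.simple j) ^ n)⁻¹,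
        p.2 + ∑ k ∈ Finset.range (2 * n),
          if p.1 = cs.simple j * (cs.simple i * cs.simple j) ^ k then 1 else 0) := by
  induction n with
  | zero => simp [functionEnd_one_apply]
  | succ n ih =>
    set c := cs.simple i * cs.simple j with hc
    have hinv (k : ℕ) : (c ^ k)⁻¹ * cs.simple j = cs.simple j * c ^ k := by
      induction k with
      | zero => simp
      | succ k ihk =>
        rw [pow_succ' c k, mul_inv_rev, mul_assoc, show c⁻¹ * cs.simple j = cs.simple j * c by
          simp [hc, mul_assoc], ← mul_assoc, ihk, mul_assoc, ← pow_succ, ← pow_succ']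
    have h₁ : c ^ n * p.1 * (c ^ n)⁻¹ = cs.simple j ↔ p.1 = cs.simple j * c ^ (2 * n) := by
      rw [two_mul, pow_add, ← mul_assoc, ← hinv, mul_inv_eq_iff_eq_mul, mul_assoc,
        eq_inv_mul_iff_mul_eq]
    have h₂ : cs.simple j * (c ^ n * p.1 * (c ^ n)⁻¹) * cs.simple j = cs.simple i ↔
        p.1 = cs.simple j * c ^ (2 * n + 1) := by
      have : cs.simple j * c ^ (2 * n + 1) =
          (c ^ n)⁻¹ * (cs.simple j * cs.simple i * cs.simple j) * c ^ n := by
        rw [show 2 * n + 1 = n + 1 + n by ring, pow_add, pow_succ, ← mul_assoc, ← mul_assoc,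
          ← hinv]
        simp [hc, mul_assoc]
      rw [this]
      constructor
      · intro h
        rw [← h]
        simp [mul_assoc]
      · intro h
        rw [h]
        simp [mul_assoc]
    rw [pow_succ', functionEnd_mul_apply, ih,
      show 2 * (n + 1) = 2 * n + 1 + 1 by ring, Finset.sum_range_succ, Finset.sum_range_succ]
    simp only [functionEnd_mul_apply, signedConj, h₁, h₂]
    refine Prod.ext ?_ ?_
    · simp [hc, pow_succ', mul_assoc]
    · simp [add_assoc]

theorem isLiftable_signedConj (cs : CoxeterSystem M W) : M.IsLiftable (signedConj cs) := by
  classical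
  intro i j
  funext p
  rw [signedConj_mul_pow_apply, two_mul, Finset.sum_range_add]
  simp only [pow_add, cs.simple_mul_simple_pow, one_mul, inv_one, mul_one]
  simp [CharTwo.add_self_eq_zero, functionEnd_one_apply]

/-- The parity of the number of occurrences of `t` in the right inversion sequence of any word
for `w`. -/
noncomputable def inversionParity (cs : CoxeterSystem M W) (w t : W) : ZMod 2 :=
  (cs.lift ⟨signedConj cs, isLiftable_signedConj cs⟩ w (t, 0)).2

theorem lift_signedConj_apply (cs : CoxeterSystem M W) (w : W) (p : W × ZMod 2) :
    cs.lift ⟨signedConj cs, isLiftable_signedConj cs⟩ w p =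
      (w * p.1 * w⁻¹, p.2 + inversionParity cs w p.1) := by
  induction w using cs.simple_induction_left generalizing p with
  | one => simp [inversionParity, functionEnd_one_apply]
  | mul_simple_left w i ih =>
    have hstep (q : W × ZMod 2) :
        cs.lift ⟨signedConj cs, isLiftable_signedConj cs⟩ (cs.simple i * w) q =
          signedConj cs i (w * q.1 * w⁻¹, q.2 + inversionParity cs w q.1) := by
      rw [map_mul, functionEnd_mul_apply, ih, cs.lift_apply_simple]
    rw [inversionParity, hstep, hstep]
    simp [signedConj, mul_assoc, add_assoc]

theorem inversionParity_mul (cs : CoxeterSystem M W) (u v t : W) :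
    inversionParity cs (u * v) t =
      inversionParity cs v t + inversionParity cs u (v * t * v⁻¹) := by
  conv_lhs => rw [inversionParity, map_mul, functionEnd_mul_apply,
    lift_signedConj_apply, lift_signedConj_apply]
  simp

theorem inversionParity_one (cs : CoxeterSystem M W) (t : W) : inversionParity cs 1 t = 0 := by
  simp [inversionParity, functionEnd_one_apply]

open Classical in
theorem inversionParity_simple (cs : CoxeterSystem M W) (i : B) (t : W) :
    inversionParity cs (cs.simple i) t = if t = cs.simple i then 1 else 0 := by
  simp [inversionParity, cs.lift_apply_simple, signedConj]

theorem mem_rightInvSeq_of_inversionParity_ne_zero (cs : CoxeterSystem M W) {ω : List B} {t : W}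
    (h : inversionParity cs (cs.wordProd ω) t ≠ 0) : t ∈ cs.rightInvSeq ω := by
  classical
  induction ω with
  | nil => simp [inversionParity_one] at h
  | cons i ω ih =>
    rw [CoxeterSystem.rightInvSeq, List.mem_cons]
    rw [cs.wordProd_cons, inversionParity_mul, inversionParity_simple] at h
    by_cases ht : cs.wordProd ω * t * (cs.wordProd ω)⁻¹ = cs.simple i
    · left
      rw [← ht]
      simp [mul_assoc]
    · right
      exact ih (by simpa [ht] using h)

theorem length_mul_lt_of_inversionParity_ne_zero (cs : CoxeterSystem M W) {w t : W}
    (h : inversionParity cs w t ≠ 0) : cs.length (w * t) < cs.length w := by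
  obtain ⟨ω, hω, rfl⟩ := cs.exists_isReduced w
  exact (cs.isRightInversion_of_mem_rightInvSeq hω
    (mem_rightInvSeq_of_inversionParity_ne_zero cs h)).2

theorem isRightDescent_iff_inversionParity_ne_zero (cs : CoxeterSystem M W) {w : W} {i : B} :
    cs.IsRightDescent w i ↔ inversionParity cs w (cs.simple i) ≠ 0 := by
  refine ⟨fun h h₀ ↦ ?_, length_mul_lt_of_inversionParity_ne_zero cs⟩
  have hlt : cs.length (w * cs.simple i * cs.simple i) < cs.length (w * cs.simple i) := by
    apply length_mul_lt_of_inversionParity_ne_zero cs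
    simp [inversionParity_mul, inversionParity_simple, h₀]
  rw [cs.simple_mul_simple_cancel_right] at hlt
  exact lt_asymm h hlt

end InversionParity

/-- The exchange property. -/
theorem exists_wordProd_mul_simple_eq_eraseIdx (cs : CoxeterSystem M W) {ω : List B} {i : B}
    (h : cs.IsRightDescent (cs.wordProd ω) i) :
    ∃ k < ω.length, cs.wordProd ω * cs.simple i = cs.wordProd (ω.eraseIdx k) := by
  have hmem := mem_rightInvSeq_of_inversionParity_ne_zero cs
    ((isRightDescent_iff_inversionParity_ne_zero cs).1 h)
  obtain ⟨k, hk, hki⟩ := List.getElem_of_mem hmem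
  refine ⟨k, by simpa using hk, ?_⟩
  rw [← cs.wordProd_mul_getD_rightInvSeq, List.getD_eq_getElem _ _ hk, hki]

theorem simple_mem_parabolic (cs : CoxeterSystem M W) {J : Set B} {j : B} (hj : j ∈ J) :
    cs.simple j ∈ parabolic cs J :=
  Subgroup.subset_closure (Set.mem_image_of_mem _ hj)

theorem parabolic_mono (cs : CoxeterSystem M W) {I J : Set B} (h : I ⊆ J) :
    parabolic cs I ≤ parabolic cs J :=
  Subgroup.closure_mono (Set.image_mono h)

theorem exists_isReduced_of_mem_parabolic (cs : CoxeterSystem M W) {J : Set B} {w : W}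
    (hw : w ∈ parabolic cs J) :
    ∃ ω : List B, (∀ j ∈ ω, j ∈ J) ∧ cs.IsReduced ω ∧ w = cs.wordProd ω := by
  have step (w : W) (j : B) (hj : j ∈ J)
      (hw : ∃ ω : List B, (∀ j ∈ ω, j ∈ J) ∧ cs.IsReduced ω ∧ w = cs.wordProd ω) :
      ∃ ω : List B, (∀ j ∈ ω, j ∈ J) ∧ cs.IsReduced ω ∧ w * cs.simple j = cs.wordProd ω := by
    obtain ⟨ω, hωJ, hω, rfl⟩ := hw
    by_cases hd : cs.IsRightDescent (cs.wordProd ω) j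
    · obtain ⟨k, hk, hkω⟩ := exists_wordProd_mul_simple_eq_eraseIdx cs hd
      refine ⟨ω.eraseIdx k, fun i hi ↦ hωJ i (List.mem_of_mem_eraseIdx hi), ?_, hkω⟩
      rw [cs.isRightDescent_iff, hkω, hω.eq] at hd
      rw [CoxeterSystem.IsReduced, List.length_eraseIdx_of_lt hk]
      omega
    · refine ⟨ω.concat j, ?_, ?_, (cs.wordProd_concat j ω).symm⟩
      · simp only [List.concat_eq_append, List.mem_append, List.mem_singleton]
        rintro i (hi | rfl)
        exacts [hωJ i hi, hj]
      · rw [cs.not_isRightDescent_iff, hω.eq] at hd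
        rw [CoxeterSystem.IsReduced, cs.wordProd_concat, hd, List.length_concat]
  induction hw using Subgroup.closure_induction_right with
  | one => exact ⟨[], by simp, by simp [CoxeterSystem.IsReduced], by simp⟩
  | mul_right w _ y hy ih =>
    obtain ⟨j, hj, rfl⟩ := hy
    exact step w j hj ih
  | mul_inv_cancel w _ y hy ih =>
    obtain ⟨j, hj, rfl⟩ := hy
    rw [cs.inv_simple]
    exact step w j hj ih

theorem wle_mul_simple (cs : CoxeterSystem M W) {u v : W} {i : B} (h : wle cs u v)
    (hv : cs.IsRightDescent v i) (hu : ¬ cs.IsRightDescent u i) :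
    wle cs (u * cs.simple i) v := by
  have hlt : cs.length (v * u⁻¹ * (u * cs.simple i * u⁻¹)) < cs.length (v * u⁻¹) := by
    apply length_mul_lt_of_inversionParity_ne_zero cs
    rw [isRightDescent_iff_inversionParity_ne_zero] at hv hu
    rw [← inv_mul_cancel_right v u, inversionParity_mul, not_not.1 hu, zero_add] at hv
    exact hv
  have heq : v * u⁻¹ * (u * cs.simple i * u⁻¹) = v * (u * cs.simple i)⁻¹ := by
    simp [mul_assoc]
  rw [heq] at hlt
  have hle := cs.length_mul_le (v * (u * cs.simple i)⁻¹) (u * cs.simple i)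
  rw [inv_mul_cancel_right] at hle
  rw [cs.not_isRightDescent_iff] at hu
  unfold wle at h ⊢
  omega

theorem wle_of_forall_isRightDescent (cs : CoxeterSystem M W) {J : Set B} {v w : W}
    (hw : w ∈ parabolic cs J) (hv : ∀ j ∈ J, cs.IsRightDescent v j) : wle cs w v := by
  obtain ⟨ω, hωJ, hω, rfl⟩ := exists_isReduced_of_mem_parabolic cs hw
  clear hw
  induction ω using List.reverseRecOn with
  | nil => simp [wle]
  | append_singleton ω j ih =>
    have hred : cs.IsReduced ω := by simpa using hω.take ω.length
    have hprod : cs.wordProd (ω ++ [j]) = cs.wordProd ω * cs.simple j := by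
      simp [cs.wordProd_append]
    rw [hprod]
    refine wle_mul_simple cs (ih (fun i hi ↦ hωJ i (by simp [hi])) hred) (hv j (hωJ j (by simp))) ?_
    rw [cs.not_isRightDescent_iff, ← hprod, hω.eq, hred.eq, List.length_append,
      List.length_singleton]

theorem isRightDescent_of_wle (cs : CoxeterSystem M W) {u v : W} {i : B} (h : wle cs u v)
    (hu : cs.IsRightDescent u i) : cs.IsRightDescent v i := by
  have hle := cs.length_mul_le (v * u⁻¹) (u * cs.simple i)
  rw [← mul_assoc, inv_mul_cancel_right] at hle
  unfold CoxeterSystem.IsRightDescent wle at *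
  omega

theorem w0_spec (cs : CoxeterSystem M W) {J : Set B} (hfin : (parabolic cs J : Set W).Finite) :
    w0 cs J ∈ parabolic cs J ∧ ∀ u ∈ parabolic cs J, cs.length u ≤ cs.length (w0 cs J) := by
  have h : ∃ w ∈ parabolic cs J, ∀ u ∈ parabolic cs J, cs.length u ≤ cs.length w :=
    Set.exists_max_image _ cs.length hfin ⟨1, one_mem _⟩
  rw [w0, dif_pos h]
  exact h.choose_spec

theorem isRightDescent_w0 (cs : CoxeterSystem M W) {J : Set B}
    (hfin : (parabolic cs J : Set W).Finite) {j : B} (hj : j ∈ J) :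
    cs.IsRightDescent (w0 cs J) j := by
  obtain ⟨hmem, hmax⟩ := w0_spec cs hfin
  exact lt_of_le_of_ne (hmax _ (mul_mem hmem (simple_mem_parabolic cs hj)))
    (cs.length_mul_simple_ne _ j)

/-- if `W_{I ∪ J}` is finite, then the join of `w0(I)` and `w0(J)` in the
left weak order exists and equals `w0(I ∪ J)`. -/
theorem join_w0_eq_w0_union (cs : CoxeterSystem M W) (I J : Set B)
    (hfin : (parabolic cs (I ∪ J) : Set W).Finite) :
    wle cs (w0 cs I) (w0 cs (I ∪ J)) ∧ wle cs (w0 cs J) (w0 cs (I ∪ J)) ∧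
      ∀ v : W, wle cs (w0 cs I) v → wle cs (w0 cs J) v → wle cs (w0 cs (I ∪ J)) v := by
  have hI := hfin.subset (parabolic_mono cs (Set.subset_union_left (s := I) (t := J)))
  have hJ := hfin.subset (parabolic_mono cs (Set.subset_union_right (s := I) (t := J)))
  refine ⟨wle_of_forall_isRightDescent cs (w0_spec cs hI).1
      fun i hi ↦ isRightDescent_w0 cs hfin (Or.inl hi),
    wle_of_forall_isRightDescent cs (w0_spec cs hJ).1
      fun j hj ↦ isRightDescent_w0 cs hfin (Or.inr hj),
    fun v hIv hJv ↦ wle_of_forall_isRightDescent cs (w0_spec cs hfin).1 ?_⟩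
  rintro k (hk | hk)
  · exact isRightDescent_of_wle cs hIv (isRightDescent_w0 cs hI hk)
  · exact isRightDescent_of_wle cs hJv (isRightDescent_w0 cs hJ hk)

end CoxeterCharPoly
end

section
/- Let (W,S) be a Coxeter system and let u, v ∈ W have reduced expressions u = u_t⋯u_2u_1 and v = v_r⋯v_2v_1 (with all u_i, v_j ∈ S) such that u_i ≠ v_j for all 1 ≤ i ≤ t and 1 ≤ j ≤ r, and suppose ℓ(vu) = ℓ(v) + ℓ(u). Then for each k with v_k ∈ D_R(v): there exists an index i with v_k u_i ≠ u_i v_k if and only if v_k ∉ D_R(vu). -/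
open Polynomial

namespace CoxeterCharPoly

variable {B W : Type*} [Group W] {M : CoxeterMatrix B}

/-- The right descent set of `w`, as a subset of `B`. -/
def rightDescents (cs : CoxeterSystem M W) (w : W) : Set B :=
  {i | cs.IsRightDescent w i}

/- `μ` is the Möbius function of the subposet `A` of the order `le`. -/
open Classical in
def IsMobiusOn {α : Type*} (le : α → α → Prop) (A : Set α) (μ : α → α → ℤ) : Prop :=
  ∀ a ∈ A, ∀ b ∈ A, le a b →
    (∑ᶠ t ∈ {t | t ∈ A ∧ le a t ∧ le t b}, μ a t) = if a = b then 1 else 0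

section GeometricRepresentation

open Real in
/-- The linear functional `2 ⟨α_i, -⟩` of the standard geometric representation. -/
noncomputable def simpleCoroot (M : CoxeterMatrix B) (i : B) : (B →₀ ℝ) →ₗ[ℝ] ℝ :=
  Finsupp.linearCombination ℝ fun j ↦ -2 * cos (π / M i j)

lemma simpleCoroot_single (M : CoxeterMatrix B) (i j : B) :
    simpleCoroot M i (Finsupp.single j 1) = -2 * Real.cos (Real.pi / M i j) := by
  simp [simpleCoroot]

lemma simpleCoroot_single_self (M : CoxeterMatrix B) (i : B) :
    simpleCoroot M i (Finsupp.single i 1) = 2 := by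
  simp [simpleCoroot_single]

/-- The simple reflections of the standard geometric representation. -/
noncomputable def simpleReflection (M : CoxeterMatrix B) (i : B) :
    (B →₀ ℝ) ≃ₗ[ℝ] (B →₀ ℝ) :=
  Module.reflection (simpleCoroot_single_self M i)

lemma simpleReflection_apply (M : CoxeterMatrix B) (i : B) (z : B →₀ ℝ) :
    simpleReflection M i z = z - simpleCoroot M i z • Finsupp.single i 1 :=
  Module.reflection_apply ..

open Polynomial.Chebyshev in
lemma isLiftable_simpleReflection (M : CoxeterMatrix B) :
    M.IsLiftable (simpleReflection M) := by
  intro i j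
  rcases eq_or_ne (M i j) 0 with h0 | h0
  · simp [h0]
  rcases eq_or_ne i j with rfl | hij
  · ext1 z
    rw [M.diagonal, pow_one]
    exact Module.involutive_reflection (simpleCoroot_single_self M i) z
  have h1 : M i j ≠ 1 := M.off_diagonal i j hij
  ext1 z
  set m := M i j with hm
  have hij' := simpleCoroot_single M i j
  have hji' := simpleCoroot_single M j i
  rw [M.symmetric j i] at hji'
  rw [← hm] at hij' hji'
  have ht : 2 * Real.cos (2 * (Real.pi / m)) = simpleCoroot M i (Finsupp.single j 1) *
      simpleCoroot M j (Finsupp.single i 1) - 2 := by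
    rw [hij', hji', Real.cos_two_mul]
    ring
  rw [simpleReflection, simpleReflection,
    Module.reflection_mul_reflection_pow_apply _ _ m z _ ht]
  rcases eq_or_ne m 2 with h2 | h2
  · have hc : Real.cos (2 * (Real.pi / (2 : ℕ))) = -1 := by
      rw [show 2 * (Real.pi / (2 : ℕ)) = Real.pi by push_cast; ring]
      exact Real.cos_pi
    rw [hij', hji', h2, hc]
    norm_num
    abel
  have hm3 : 3 ≤ m := by lia
  have hm0 : (0 : ℝ) < m := by positivity
  set θ := 2 * (Real.pi / m) with hθ
  have hmθ : m * θ = 2 * Real.pi := by rw [hθ]; field_simp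
  have hs : Real.sin θ ≠ 0 := by
    refine (Real.sin_pos_of_pos_of_lt_pi (by positivity) ?_).ne'
    have : (3 : ℝ) ≤ m := by exact_mod_cast hm3
    have := Real.pi_pos
    by_contra! h
    nlinarith
  have hS (n : ℤ) : (S ℝ n).eval (2 * Real.cos θ) * Real.sin θ = Real.sin ((n + 1) * θ) :=
    S_two_mul_real_cos θ n
  rcases Nat.even_or_odd' m with ⟨k, hk | hk⟩
  · have h3 : (S ℝ ((k : ℤ) - 1)).eval (2 * Real.cos θ) = 0 := by
      apply (mul_eq_zero_iff_right hs).mp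
      rw [hS, ← Real.sin_pi]
      congr 1
      rw [hk] at hmθ
      push_cast at hmθ ⊢
      linarith
    rw [show ((m : ℤ) - 2) / 2 = k - 1 by lia, show ((m : ℤ) - 1) / 2 = k - 1 by lia, h3]
    simp
  · have h3 : (S ℝ (k : ℤ)).eval (2 * Real.cos θ) +
        (S ℝ ((k : ℤ) - 1)).eval (2 * Real.cos θ) = 0 := by
      apply (mul_eq_zero_iff_right hs).mp
      rw [add_mul, hS, hS]
      rw [hk] at hmθ
      push_cast at hmθ ⊢
      rw [show ((k : ℝ) + 1) * θ = 2 * Real.pi - k * θ by linarith, Real.sin_two_pi_sub]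
      simp
    rw [show ((m : ℤ) - 2) / 2 = k - 1 by lia, show ((m : ℤ) - 1) / 2 = k by lia,
      show ((m : ℤ) - 3) / 2 = k - 1 by lia, show (m : ℤ) / 2 = k by lia, h3]
    simp

/-- The standard geometric representation of a Coxeter group. -/
noncomputable def geometricRep (cs : CoxeterSystem M W) : W →* ((B →₀ ℝ) ≃ₗ[ℝ] (B →₀ ℝ)) :=
  cs.lift ⟨simpleReflection M, isLiftable_simpleReflection M⟩

lemma geometricRep_simple (cs : CoxeterSystem M W) (i : B) :
    geometricRep cs (cs.simple i) = simpleReflection M i :=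
  cs.lift_apply_simple _ i

lemma geometricRep_wordProd_apply (cs : CoxeterSystem M W) {ω : List B} {b : B} (hb : b ∉ ω)
    (z : B →₀ ℝ) : geometricRep cs (cs.wordProd ω) z b = z b := by
  induction ω with
  | nil => simp
  | cons a ω ih =>
    rw [List.mem_cons, not_or] at hb
    rw [cs.wordProd_cons, map_mul, LinearEquiv.mul_apply, geometricRep_simple,
      simpleReflection_apply]
    simp [ih hb.2, Finsupp.single_eq_of_ne hb.1]

end GeometricRepresentation

lemma mem_of_simple_eq_wordProd (cs : CoxeterSystem M W) {b : B} {ω : List B}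
    (h : cs.simple b = cs.wordProd ω) : b ∈ ω := by
  by_contra hb
  have := geometricRep_wordProd_apply cs hb (Finsupp.single b 1)
  rw [← h, geometricRep_simple, simpleReflection_apply, simpleCoroot_single_self] at this
  norm_num at this

section Exchange

open Classical in
/-- The action of a simple reflection on pairs of a group element, conjugated by the reflection,
and a parity, changed exactly when the element is that reflection. -/
noncomputable def parityAction (cs : CoxeterSystem M W) (i : B) :
    Function.End (W × ZMod 2) :=
  fun p ↦ (cs.simple i * p.1 * cs.simple i, p.2 + if p.1 = cs.simple i then 1 else 0)

open Classical in
lemma parityAction_mul_pow_apply (cs : CoxeterSystem M W) (i j : B) (n : ℕ) (p : W × ZMod 2) :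
    ((parityAction cs i * parityAction cs j) ^ n) p =
      ((cs.simple i * cs.simple j) ^ n * p.1 * ((cs.simple i * cs.simple j) ^ n)⁻¹,
        p.2 + ∑ k ∈ Finset.range (2 * n),
          if (cs.simple i * cs.simple j) ^ k * p.1 = cs.simple j then 1 else 0) := by
  induction n with
  | zero => simp; rfl
  | succ n ih =>
    set r := cs.simple i * cs.simple j with hr
    have hrj (k : ℕ) : cs.simple j * r ^ k = (r ^ k)⁻¹ * cs.simple j := by
      have : cs.simple j * r * (cs.simple j)⁻¹ = r⁻¹ := by simp [hr, mul_assoc]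
      rw [← inv_pow, ← this, conj_pow]
      simp
    have e1 : r ^ n * p.1 * (r ^ n)⁻¹ = cs.simple j ↔ r ^ (2 * n) * p.1 = cs.simple j := by
      rw [mul_inv_eq_iff_eq_mul, hrj, eq_inv_mul_iff_mul_eq, two_mul, pow_add, mul_assoc]
    have e2 : cs.simple j * (r ^ n * p.1 * (r ^ n)⁻¹) * cs.simple j = cs.simple i ↔
        r ^ (2 * n + 1) * p.1 = cs.simple j := by
      have h1 : cs.simple j * (r ^ n * p.1 * (r ^ n)⁻¹) * cs.simple j = cs.simple i ↔
          r ^ n * p.1 * (r ^ n)⁻¹ = r⁻¹ * cs.simple j := by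
        rw [← mul_right_inj (cs.simple j), ← mul_left_inj (cs.simple j)]
        simp [hr, mul_assoc]
      rw [h1, mul_inv_eq_iff_eq_mul, mul_assoc, hrj, eq_inv_mul_iff_mul_eq,
        eq_inv_mul_iff_mul_eq,
        show r ^ (2 * n + 1) = r ^ n * (r * r ^ n) by rw [← pow_succ', ← pow_add]; congr 1; lia]
      simp only [mul_assoc]
    rw [pow_succ']
    change parityAction cs i (parityAction cs j (((parityAction cs i * parityAction cs j) ^ n) p))
      = _
    rw [ih, show 2 * (n + 1) = 2 * n + 1 + 1 by ring, Finset.sum_range_succ,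
      Finset.sum_range_succ]
    simp only [parityAction, e1, e2]
    refine Prod.ext ?_ ?_
    · simp [pow_succ', hr, mul_assoc]
    · simp [add_assoc]

lemma isLiftable_parityAction (cs : CoxeterSystem M W) : M.IsLiftable (parityAction cs) := by
  classical
  intro i j
  funext p
  rw [parityAction_mul_pow_apply, cs.simple_mul_simple_pow, two_mul, Finset.sum_range_add]
  simp only [pow_add, cs.simple_mul_simple_pow, one_mul, inv_one, mul_one, CharTwo.add_self_eq_zero,
    add_zero]
  rfl

open Classical in
lemma lift_parityAction_wordProd (cs : CoxeterSystem M W) (ω : List B) (p : W × ZMod 2) :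
    cs.lift ⟨parityAction cs, isLiftable_parityAction cs⟩ (cs.wordProd ω) p =
      (cs.wordProd ω * p.1 * (cs.wordProd ω)⁻¹, p.2 + (cs.rightInvSeq ω).count p.1) := by
  induction ω with
  | nil => simp; rfl
  | cons a ω ih =>
    rw [cs.wordProd_cons, map_mul, cs.lift_apply_simple]
    change parityAction cs a (cs.lift ⟨parityAction cs, _⟩ (cs.wordProd ω) p) = _
    rw [ih, CoxeterSystem.rightInvSeq, List.count_cons]
    have : cs.wordProd ω * p.1 * (cs.wordProd ω)⁻¹ = cs.simple a ↔
        (cs.wordProd ω)⁻¹ * cs.simple a * cs.wordProd ω = p.1 := by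
      rw [mul_inv_eq_iff_eq_mul, ← inv_mul_eq_iff_eq_mul, eq_comm, mul_assoc]
      simp only [eq_inv_mul_iff_mul_eq, inv_mul_eq_iff_eq_mul]
    simp only [parityAction, this, beq_iff_eq]
    refine Prod.ext ?_ ?_
    · simp [mul_assoc]
    · push_cast
      simp [add_assoc]

/-- The exchange property. -/
lemma exists_eraseIdx_of_isRightDescent (cs : CoxeterSystem M W) {ω : List B} {b : B}
    (h : cs.IsRightDescent (cs.wordProd ω) b) :
    ∃ j < ω.length, cs.wordProd ω * cs.simple b = cs.wordProd (ω.eraseIdx j) := by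
  classical
  obtain ⟨η, hη, hηω⟩ := cs.exists_isReduced (cs.wordProd ω * cs.simple b)
  have hω : cs.wordProd ω = cs.wordProd (η.concat b) := by
    rw [cs.wordProd_concat, ← hηω]
    simp
  have hred : cs.IsReduced (η.concat b) := by
    rw [CoxeterSystem.IsReduced, ← hω, ← cs.isRightDescent_iff.mp h, hηω, hη.eq]
    simp
  have hcount : (cs.rightInvSeq (η.concat b)).count (cs.simple b) = 1 :=
    List.count_eq_one_of_mem hred.nodup_rightInvSeq (by rw [cs.rightInvSeq_concat]; simp)
  have hpar := lift_parityAction_wordProd cs ω (cs.simple b, 0)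
  rw [hω, lift_parityAction_wordProd, hcount, ← hω] at hpar
  have hmem : cs.simple b ∈ cs.rightInvSeq ω := by
    by_contra hb
    rw [List.count_eq_zero_of_not_mem hb] at hpar
    simp at hpar
  obtain ⟨j, hj, hjb⟩ := List.mem_iff_getElem.mp hmem
  refine ⟨j, by simpa using hj, ?_⟩
  rw [← cs.wordProd_mul_getD_rightInvSeq, List.getD_eq_getElem _ 1 hj, hjb]

end Exchange

lemma subset_of_isReduced_of_wordProd_eq (cs : CoxeterSystem M W) {η : List B}
    (hη : cs.IsReduced η) {ω : List B} (h : cs.wordProd η = cs.wordProd ω) : η ⊆ ω := by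
  induction η using List.reverseRecOn generalizing ω with
  | nil => simp
  | append_singleton η b ih =>
    have hη' : cs.IsReduced η := by simpa using hη.take η.length
    have hprod : cs.wordProd ω * cs.simple b = cs.wordProd η := by
      rw [← h, cs.wordProd_append]
      simp
    have hdesc : cs.IsRightDescent (cs.wordProd ω) b := by
      rw [CoxeterSystem.IsRightDescent, hprod, hη'.eq, ← h, hη.eq]
      simp
    obtain ⟨j, -, hj⟩ := exists_eraseIdx_of_isRightDescent cs hdesc
    have hsub : ω.eraseIdx j ⊆ ω := (List.eraseIdx_sublist ω j).subset
    have hb : b ∈ ω.reverse ++ ω.eraseIdx j := by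
      apply mem_of_simple_eq_wordProd cs
      rw [cs.wordProd_append, ← hj]
      simp
    have hb' : b ∈ ω := by
      rcases List.mem_append.mp hb with hb | hb
      · simpa using hb
      · exact hsub hb
    refine List.append_subset.mpr ⟨fun c hc ↦ ?_, by simpa using hb'⟩
    exact hsub (ih hη' (hprod.symm.trans hj) hc)

/-- A word in letters that do not include `b` does not have `b` as a right descent. -/
lemma not_isRightDescent_wordProd_of_not_mem (cs : CoxeterSystem M W) {ω : List B} {b : B}
    (hb : b ∉ ω) : ¬ cs.IsRightDescent (cs.wordProd ω) b := by
  intro h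
  obtain ⟨j, -, hj⟩ := exists_eraseIdx_of_isRightDescent cs h
  have : b ∈ ω.reverse ++ ω.eraseIdx j := by
    apply mem_of_simple_eq_wordProd cs
    rw [cs.wordProd_append, ← hj]
    simp
  rcases List.mem_append.mp this with h | h
  · exact hb (by simpa using h)
  · exact hb ((List.eraseIdx_sublist ω j).subset h)

lemma wordProd_eq_one_of_disjoint (cs : CoxeterSystem M W) {ω η : List B}
    (hd : ω.Disjoint η) (h : cs.wordProd ω = cs.wordProd η) : cs.wordProd ω = 1 := by
  obtain ⟨ξ, hξ, hξω⟩ := cs.exists_isReduced (cs.wordProd ω)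
  have h1 := subset_of_isReduced_of_wordProd_eq cs hξ hξω.symm
  have h2 := subset_of_isReduced_of_wordProd_eq cs hξ (hξω.symm.trans h)
  have : ξ = [] := List.eq_nil_iff_forall_not_mem.mpr fun a ha ↦ hd (h1 ha) (h2 ha)
  rw [hξω, this, cs.wordProd_nil]

lemma simple_ne_one (cs : CoxeterSystem M W) (b : B) : cs.simple b ≠ 1 := by
  intro h
  have := cs.length_simple b
  rw [h, cs.length_one] at this
  exact zero_ne_one this

lemma isReduced_append_of_disjoint (cs : CoxeterSystem M W) {ξ η : List B}
    (hξ : cs.IsReduced ξ) (hη : cs.IsReduced η) (hd : ξ.Disjoint η) :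
    cs.IsReduced (ξ ++ η) := by
  induction η using List.reverseRecOn with
  | nil => simpa using hξ
  | append_singleton η a ih =>
    have hη' : cs.IsReduced η := by simpa using hη.take η.length
    have hd' : ξ.Disjoint η := fun c hc hc' ↦ hd hc (by simp [hc'])
    have hred := ih hη' hd'
    have hnd : ¬ cs.IsRightDescent (cs.wordProd (ξ ++ η)) a := by
      intro hdesc
      obtain ⟨j, hj, hja⟩ := exists_eraseIdx_of_isRightDescent cs hdesc
      rcases lt_or_ge j ξ.length with hlt | hge
      · rw [List.eraseIdx_append_of_lt_length hlt, cs.wordProd_append, cs.wordProd_append] at hja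
        have h1 : cs.wordProd (η ++ a :: η.reverse) =
            cs.wordProd (ξ.reverse ++ ξ.eraseIdx j) := by
          simp only [cs.wordProd_append, cs.wordProd_cons, cs.wordProd_reverse]
          rw [eq_inv_mul_iff_mul_eq, ← mul_assoc, ← mul_assoc, hja]
          simp
        have h2 := wordProd_eq_one_of_disjoint cs ?_ h1
        · simp only [cs.wordProd_append, cs.wordProd_cons, cs.wordProd_reverse] at h2
          rw [← mul_assoc, conj_eq_one_iff] at h2
          exact simple_ne_one cs a h2
        · intro c hc hc'
          refine @hd c ?_ ?_
          · rcases List.mem_append.mp hc' with h | h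
            · simpa using h
            · exact (List.eraseIdx_sublist ξ j).subset h
          · simpa [or_comm, or_left_comm] using hc
      · rw [List.eraseIdx_append_of_length_le hge, cs.wordProd_append, cs.wordProd_append,
          mul_assoc, mul_right_inj] at hja
        have h1 := hη.eq
        rw [cs.wordProd_append, cs.wordProd_singleton, hja] at h1
        have h2 := cs.length_wordProd_le (η.eraseIdx (j - ξ.length))
        have h3 := (List.eraseIdx_sublist η (j - ξ.length)).length_le
        simp at h1
        lia
    rw [cs.not_isRightDescent_iff, hred.eq] at hnd
    rw [CoxeterSystem.IsReduced, ← List.append_assoc, cs.wordProd_append, cs.wordProd_singleton,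
      hnd]
    simp [add_assoc]

/-- If `b a b` is a product of letters different from `b`, then `a` and `b` commute. -/
lemma commute_of_conj_eq_wordProd (cs : CoxeterSystem M W) {a b : B} {ω : List B} (hb : b ∉ ω)
    (h : cs.simple b * cs.simple a * cs.simple b = cs.wordProd ω) :
    cs.simple b * cs.simple a = cs.simple a * cs.simple b := by
  have hprod : cs.wordProd [b, a, b] = cs.simple b * cs.simple a * cs.simple b := by
    simp [cs.wordProd_cons, mul_assoc]
  have hnr : ¬ cs.IsReduced [b, a, b] := fun hr ↦
    hb (subset_of_isReduced_of_wordProd_eq cs hr (hprod.trans h) (by simp))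
  have hle : cs.length (cs.wordProd [b, a, b]) ≤ 3 := cs.length_wordProd_le [b, a, b]
  have hne : cs.length (cs.wordProd [b, a, b]) ≠ 3 := hnr
  have hodd : cs.length (cs.wordProd [b, a, b]) % 2 = 1 := by
    rw [hprod, cs.length_mul_mod_two, Nat.add_mod, cs.length_mul_mod_two]
    simp
  obtain ⟨c, hc⟩ := cs.length_eq_one_iff.mp (show cs.length (cs.wordProd [b, a, b]) = 1 by lia)
  have hmem : c ∈ [b, a, b] := mem_of_simple_eq_wordProd cs hc.symm
  have hcω : c ∈ ω := mem_of_simple_eq_wordProd cs (hc.symm.trans (hprod.trans h))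
  have hca : c = a := by
    have : c ≠ b := fun h ↦ hb (h ▸ hcω)
    simpa [this] using hmem
  rw [hprod, hca] at hc
  nth_rw 2 [← hc]
  simp

lemma commute_of_commute_wordProd (cs : CoxeterSystem M W) {ω : List B} {b : B}
    (hω : cs.IsReduced ω) (hb : b ∉ ω)
    (h : cs.wordProd ω * cs.simple b = cs.simple b * cs.wordProd ω) :
    ∀ a ∈ ω, cs.simple b * cs.simple a = cs.simple a * cs.simple b := by
  induction ω using List.reverseRecOn with
  | nil => simp
  | append_singleton η a ih =>
    have hη : cs.IsReduced η := by simpa using hω.take η.length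
    have hnd := not_isRightDescent_wordProd_of_not_mem cs hb
    rw [cs.not_isRightDescent_iff, hω.eq] at hnd
    have hdesc : cs.IsRightDescent (cs.wordProd (η ++ [a] ++ [b])) a := by
      have h1 := cs.length_wordProd_le (b :: η)
      rw [CoxeterSystem.IsRightDescent, cs.wordProd_append _ [b], cs.wordProd_singleton, hnd, h]
      simp only [cs.wordProd_append, cs.wordProd_singleton, ← mul_assoc,
        cs.simple_mul_simple_cancel_right]
      rw [cs.wordProd_cons] at h1
      simp at h1 ⊢
      lia
    obtain ⟨j, hj, hja⟩ := exists_eraseIdx_of_isRightDescent cs hdesc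
    have hab : cs.simple b * cs.simple a = cs.simple a * cs.simple b := by
      rcases lt_or_ge j (η ++ [a]).length with hlt | hge
      · rw [List.eraseIdx_append_of_lt_length hlt, cs.wordProd_append _ [b],
          cs.wordProd_append _ [b], cs.wordProd_singleton] at hja
        refine commute_of_conj_eq_wordProd cs
          (ω := (η ++ [a]).reverse ++ (η ++ [a]).eraseIdx j) ?_ ?_
        · rw [List.mem_append, List.mem_reverse, not_or]
          exact ⟨hb, fun h ↦ hb ((List.eraseIdx_sublist _ j).subset h)⟩
        · rw [cs.wordProd_append, cs.wordProd_reverse, eq_inv_mul_iff_mul_eq, ← mul_assoc,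
            ← mul_assoc, hja, cs.simple_mul_simple_cancel_right]
      · rw [List.eraseIdx_append_of_length_le hge] at hja
        have hj0 : j - (η ++ [a]).length = 0 := by
          simp only [List.length_append, List.length_singleton] at hj ⊢
          lia
        rw [hj0, cs.wordProd_append _ [b], cs.wordProd_append _ ([b].eraseIdx 0), mul_assoc,
          mul_right_inj] at hja
        simp only [cs.wordProd_singleton, List.eraseIdx_cons_zero, cs.wordProd_nil] at hja
        have hba : cs.simple b = cs.simple a := by
          rw [mul_eq_one_iff_eq_inv.mp hja, cs.inv_simple]
        rw [hba]
    have hcomm : cs.wordProd η * cs.simple b = cs.simple b * cs.wordProd η := by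
      rw [cs.wordProd_append, cs.wordProd_singleton, mul_assoc, ← hab, ← mul_assoc, ← mul_assoc,
        mul_left_inj] at h
      exact h
    intro c hc
    rcases List.mem_append.mp hc with hc | hc
    · exact ih hη (fun h ↦ hb (by simp [h])) hcomm c hc
    · rw [List.mem_singleton.mp hc, hab]

lemma commute_wordProd_of_forall_commute (cs : CoxeterSystem M W) {ω : List B} {b : B}
    (h : ∀ a ∈ ω, cs.simple b * cs.simple a = cs.simple a * cs.simple b) :
    cs.simple b * cs.wordProd ω = cs.wordProd ω * cs.simple b := by
  refine Commute.list_prod_right _ _ fun x hx ↦ ?_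
  obtain ⟨a, ha, rfl⟩ := List.mem_map.mp hx
  exact h a ha

/-- If `ω b` equals `η ω` for words with `ω` reduced, `b` in `η`, and `ω`, `η` without common
letters, then `b` commutes with every letter of `ω`. -/
lemma commute_of_mul_simple_eq (cs : CoxeterSystem M W) {ω η : List B} {b : B}
    (hω : cs.IsReduced ω) (hd : η.Disjoint ω) (hb : b ∉ ω)
    (h : cs.wordProd ω * cs.simple b = cs.wordProd η * cs.wordProd ω) :
    ∀ a ∈ ω, cs.simple b * cs.simple a = cs.simple a * cs.simple b := by
  obtain ⟨ξ, hξ, hξη⟩ := cs.exists_isReduced (cs.wordProd η)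
  have hsub := subset_of_isReduced_of_wordProd_eq cs hξ hξη.symm
  have hξω := isReduced_append_of_disjoint cs hξ hω fun c hc hc' ↦ hd (hsub hc) hc'
  have hle : cs.length (cs.wordProd ξ * cs.wordProd ω) ≤ ω.length + 1 := by
    rw [← hξη, ← h, ← hω.eq, ← cs.length_simple b]
    exact cs.length_mul_le _ _
  rw [← cs.wordProd_append, hξω.eq, List.length_append] at hle
  have hne : ξ ≠ [] := by
    rintro rfl
    rw [hξη, cs.wordProd_nil, one_mul, mul_eq_left] at h
    exact simple_ne_one cs b h
  have hpos := List.length_pos_iff.mpr hne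
  obtain ⟨c, rfl⟩ := List.length_eq_one_iff.mp (show ξ.length = 1 by lia)
  rw [cs.wordProd_singleton] at hξη
  have hc : c ∈ ω ++ b :: ω.reverse := by
    apply mem_of_simple_eq_wordProd cs
    rw [← hξη, cs.wordProd_append, cs.wordProd_cons, cs.wordProd_reverse, ← mul_assoc, h]
    simp
  have hcω : c ∉ ω := fun hc ↦ hd (hsub (by simp)) hc
  have hcb : c = b := by simpa [hcω] using hc
  exact commute_of_commute_wordProd cs hω hb (by rw [h, hξη, hcb])

/-- let `u = u_t ⋯ u_1` and `v = v_r ⋯ v_1` be reduced words with no common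
letters, and suppose `ℓ(vu) = ℓ(v) + ℓ(u)`. Then for every letter `v_k` of the word for
`v` which is a right descent of `v`: some letter of `u` fails to commute with `v_k` iff
`v_k` is not a right descent of `vu`. -/
theorem descent_commute_iff (cs : CoxeterSystem M W) (u v : W) (lu lv : List B)
    (hu : cs.wordProd lu = u) (hv : cs.wordProd lv = v)
    (hru : cs.IsReduced lu) (hrv : cs.IsReduced lv)
    (hdistinct : ∀ a ∈ lu, ∀ b ∈ lv, a ≠ b)
    (hlen : cs.length (v * u) = cs.length v + cs.length u) :
    ∀ b ∈ lv, cs.IsRightDescent v b →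
      ((∃ a ∈ lu, cs.simple b * cs.simple a ≠ cs.simple a * cs.simple b) ↔
        ¬ cs.IsRightDescent (v * u) b) := by
  intro b hb hdesc
  subst hu hv
  have hbu : b ∉ lu := fun h ↦ hdistinct b h b hb rfl
  rw [← not_iff_not, not_not]
  push Not
  constructor
  · intro hcomm
    rw [CoxeterSystem.IsRightDescent, hlen, mul_assoc,
      ← commute_wordProd_of_forall_commute cs hcomm, ← mul_assoc]
    exact (cs.length_mul_le _ _).trans_lt (Nat.add_lt_add_right hdesc _)
  · intro h
    rw [← cs.wordProd_append] at h
    obtain ⟨j, -, hj⟩ := exists_eraseIdx_of_isRightDescent cs h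
    rcases lt_or_ge j lv.length with hlt | hge
    · rw [List.eraseIdx_append_of_lt_length hlt, cs.wordProd_append, cs.wordProd_append] at hj
      refine commute_of_mul_simple_eq cs (η := lv.reverse ++ lv.eraseIdx j) hru ?_ hbu ?_
      · intro c hc hc'
        refine hdistinct c hc' c ?_ rfl
        rcases List.mem_append.mp hc with h | h
        · simpa using h
        · exact (List.eraseIdx_sublist lv j).subset h
      · rw [cs.wordProd_append, cs.wordProd_reverse, mul_assoc, ← hj]
        simp [mul_assoc]
    · rw [List.eraseIdx_append_of_length_le hge, cs.wordProd_append, cs.wordProd_append,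
        mul_assoc, mul_right_inj] at hj
      have hmem : b ∈ lu.reverse ++ lu.eraseIdx (j - lv.length) := by
        apply mem_of_simple_eq_wordProd cs
        rw [cs.wordProd_append, ← hj]
        simp
      rcases List.mem_append.mp hmem with h | h
      · exact absurd (by simpa using h) hbu
      · exact absurd ((List.eraseIdx_sublist lu _).subset h) hbu

end CoxeterCharPoly
end

section
/- For n ≥ 1, let A_{n,k,l} be the number of subsets J ⊆ S = {1,…,n} of the Coxeter system (A_n, S) with |J| = k and ℓ(w0(J)) = l, and set A_{0,k,l} = 1 if k = l = 0 and A_{0,k,l} = 0 otherwise. Let T_A(x,y,z) = Σ_{n≥0} Σ_{k≥0} Σ_{l≥0} A_{n,k,l} x^n y^k z^l and P = Σ_{n≥0} x^n y^n z^{C(n+1,2)}, regarded as formal power series in x whose coefficients are polynomials in y and z. Then T_A(x,y,z) · (1 − x·P) = P. -/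
open Polynomial

namespace CoxeterCharPoly

variable {B W : Type*} [Group W] {M : CoxeterMatrix B}

/-- The length of the longest element of the standard parabolic subgroup `W_J` of the
Coxeter group of type `Aₙ`. -/
noncomputable def lenA (n : ℕ) (J : Finset (Fin n)) : ℕ :=
  (CoxeterMatrix.Aₙ n).toCoxeterSystem.length
    (w0 (CoxeterMatrix.Aₙ n).toCoxeterSystem (↑J : Set (Fin n)))

/-- `A_{n,k,l}`: the number of subsets `J ⊆ S` with `|J| = k` and `ℓ(w0(J)) = l`
in the Coxeter system of type `Aₙ`. (For `n = 0` this is `1` if `k = l = 0`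
and `0` otherwise.) -/
noncomputable def Acount (n k l : ℕ) : ℕ :=
  Nat.card {J : Finset (Fin n) // J.card = k ∧ lenA n J = l}

/-- The variable `y`, in the ring of polynomials in `y` and `z` over `ℤ`. -/
noncomputable def yv : Polynomial (Polynomial ℤ) := Polynomial.C Polynomial.X

/-- The variable `z`, in the ring of polynomials in `y` and `z` over `ℤ`. -/
noncomputable def zv : Polynomial (Polynomial ℤ) := Polynomial.X

/-- `T_A(x,y,z) = Σ_{n,k,l ≥ 0} A_{n,k,l} x^n y^k z^l`, as a formal power series in `x`
whose coefficients are polynomials in `y` and `z`. -/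
noncomputable def TA : PowerSeries (Polynomial (Polynomial ℤ)) :=
  PowerSeries.mk fun n => ∑ᶠ (k : ℕ), ∑ᶠ (l : ℕ), (Acount n k l : Polynomial (Polynomial ℤ)) * yv ^ k * zv ^ l

/-- `P = Σ_{n ≥ 0} x^n y^n z^(C(n+1,2))`. -/
noncomputable def Pser : PowerSeries (Polynomial (Polynomial ℤ)) :=
  PowerSeries.mk fun n => yv ^ n * zv ^ ((n + 1).choose 2)

open Finset

/-- The number of `p < q` such that all of `p, p + 1, …, q - 1` lie in `J`. -/
def runLength (J : Finset ℕ) (q : ℕ) : ℕ :=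
  #{p ∈ range q | Ico p q ⊆ J}

/-- The number of positive roots of the parabolic subsystem of type `Aₙ` spanned by `J`. -/
def rootCount (n : ℕ) (J : Finset ℕ) : ℕ :=
  ∑ q ∈ range (n + 1), runLength J q

section Descending

/-- The product `σ (b + d - 1) * ⋯ * σ (b + 1) * σ b`. -/
def descProd {G : Type*} [Monoid G] (σ : ℕ → G) : ℕ → ℕ → G
  | _, 0 => 1
  | b, d + 1 => descProd σ (b + 1) d * σ b

variable {G : Type*} [Group G] {σ : ℕ → G} {n : ℕ}

theorem descProd_mul_of_lt (hcomm : ∀ i j, i + 1 < j → σ i * σ j = σ j * σ i) (i d : ℕ) :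
    ∀ b, i + 1 < b → descProd σ b d * σ i = σ i * descProd σ b d := by
  induction d with
  | zero => simp [descProd]
  | succ d ih =>
    intro b hb
    rw [descProd, mul_assoc, ← hcomm i b hb, ← mul_assoc, ih (b + 1) (by omega), mul_assoc]

theorem descProd_mul_succ (hcomm : ∀ i j, i + 1 < j → σ i * σ j = σ j * σ i)
    (hbraid : ∀ i, i + 1 < n → σ i * σ (i + 1) * σ i = σ (i + 1) * σ i * σ (i + 1)) (i d : ℕ) :
    ∀ b, b ≤ i → i + 1 < b + d → b + d ≤ n →
      descProd σ b d * σ (i + 1) = σ i * descProd σ b d := by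
  induction d with
  | zero => intro b h1 h2; omega
  | succ d ih =>
    intro b h1 h2 h3
    rcases h1.eq_or_lt with rfl | h1
    · obtain ⟨e, rfl⟩ : ∃ e, d = e + 1 := ⟨d - 1, by omega⟩
      simp only [descProd]
      rw [mul_assoc, mul_assoc, ← mul_assoc (σ (b + 1)), ← hbraid b (by omega), mul_assoc (σ b),
        ← mul_assoc, descProd_mul_of_lt hcomm _ _ _ (by omega)]
      simp only [mul_assoc]
    · rw [descProd, mul_assoc, hcomm b (i + 1) (by omega), ← mul_assoc,
        ih (b + 1) (by omega) (by omega) (by omega), mul_assoc]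

theorem exists_mul_descProd_of_mem_closure (hsq : ∀ i, σ i * σ i = 1)
    (hcomm : ∀ i j, i + 1 < j → σ i * σ j = σ j * σ i)
    (hbraid : ∀ i, i + 1 < n → σ i * σ (i + 1) * σ i = σ (i + 1) * σ i * σ (i + 1))
    {J : Set ℕ} {m : ℕ} (hm : m + 1 ≤ n) {u : G}
    (hu : u ∈ Subgroup.closure (σ '' {j | j ∈ J ∧ j < m + 1})) :
    ∃ v ∈ Subgroup.closure (σ '' {j | j ∈ J ∧ j < m}), ∃ b d, b + d = m + 1 ∧
      (∀ k, b ≤ k → k < m + 1 → k ∈ J) ∧ u = v * descProd σ b d := by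
  have step : ∀ x : G, ∀ i ∈ J, i < m + 1 →
      (∃ v ∈ Subgroup.closure (σ '' {j | j ∈ J ∧ j < m}), ∃ b d, b + d = m + 1 ∧
        (∀ k, b ≤ k → k < m + 1 → k ∈ J) ∧ x = v * descProd σ b d) →
      ∃ v ∈ Subgroup.closure (σ '' {j | j ∈ J ∧ j < m}), ∃ b d, b + d = m + 1 ∧
        (∀ k, b ≤ k → k < m + 1 → k ∈ J) ∧ x * σ i = v * descProd σ b d := by
    rintro x i hi him ⟨v, hv, b, d, hbd, hJ, rfl⟩
    rcases lt_trichotomy (i + 1) b with h | h | h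
    · refine ⟨v * σ i, mul_mem hv (Subgroup.subset_closure ⟨i, ⟨hi, by omega⟩, rfl⟩),
        b, d, hbd, hJ, ?_⟩
      rw [mul_assoc, descProd_mul_of_lt hcomm _ _ _ h, mul_assoc]
    · refine ⟨v, hv, i, d + 1, by omega, fun k h1 h2 => ?_, ?_⟩
      · rcases h1.eq_or_lt with rfl | h1
        · exact hi
        · exact hJ k (by omega) h2
      · rw [descProd, h, mul_assoc]
    · rcases (Nat.lt_succ_iff.mp h).eq_or_lt with rfl | h
      · obtain ⟨e, rfl⟩ : ∃ e, d = e + 1 := ⟨d - 1, by omega⟩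
        refine ⟨v, hv, b + 1, e, by omega, fun k h1 h2 => hJ k (by omega) h2, ?_⟩
        rw [descProd, mul_assoc, mul_assoc, hsq, mul_one]
      · obtain ⟨j, rfl⟩ : ∃ j, i = j + 1 := ⟨i - 1, by omega⟩
        refine ⟨v * σ j, mul_mem hv (Subgroup.subset_closure ⟨j, ⟨hJ j (by omega) (by omega),
          by omega⟩, rfl⟩), b, d, hbd, hJ, ?_⟩
        rw [mul_assoc, descProd_mul_succ hcomm hbraid j d b (by omega) (by omega) (by omega),
          mul_assoc]
  induction hu using Subgroup.closure_induction_right with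
  | one => exact ⟨1, one_mem _, m + 1, 0, rfl, fun k h1 h2 => by omega, by simp [descProd]⟩
  | mul_right x _ y hy ih =>
    obtain ⟨i, ⟨hi, him⟩, rfl⟩ := hy
    exact step x i hi him ih
  | mul_inv_cancel x _ y hy ih =>
    obtain ⟨i, ⟨hi, him⟩, rfl⟩ := hy
    rw [inv_eq_of_mul_eq_one_left (hsq i)]
    exact step x i hi him ih

end Descending

section TypeA

variable {n : ℕ} {W : Type*} [Group W] (cs : CoxeterSystem (CoxeterMatrix.A n) W)

/-- The simple reflections of type `Aₙ` indexed by `ℕ`, extended by `1` beyond `n`. -/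
def natSimple (k : ℕ) : W :=
  if h : k < n then cs.simple ⟨k, h⟩ else 1

theorem natSimple_val (i : Fin n) : natSimple cs i = cs.simple i := by
  simp [natSimple]

theorem natSimple_mul_self (k : ℕ) : natSimple cs k * natSimple cs k = 1 := by
  unfold natSimple; split <;> simp

theorem natSimple_comm (i j : ℕ) (hij : i + 1 < j) :
    natSimple cs i * natSimple cs j = natSimple cs j * natSimple cs i := by
  by_cases hj : j < n
  · have hi : i < n := by omega
    simp only [natSimple, hi, hj, dif_pos]
    have h := cs.simple_mul_simple_pow ⟨i, hi⟩ ⟨j, hj⟩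
    have hM : CoxeterMatrix.A n ⟨i, hi⟩ ⟨j, hj⟩ = 2 := by
      simp only [CoxeterMatrix.A, Matrix.of_apply, Fin.mk.injEq]
      rw [if_neg (by omega), if_neg (by omega)]
    rw [hM, pow_two] at h
    rw [eq_inv_of_mul_eq_one_left h]
    simp
  · simp [natSimple, hj]

theorem natSimple_braid (i : ℕ) (hi : i + 1 < n) :
    natSimple cs i * natSimple cs (i + 1) * natSimple cs i =
      natSimple cs (i + 1) * natSimple cs i * natSimple cs (i + 1) := by
  have hi' : i < n := by omega
  simp only [natSimple, hi, hi', dif_pos]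
  have h := cs.simple_mul_simple_pow ⟨i, hi'⟩ ⟨i + 1, hi⟩
  have hM : CoxeterMatrix.A n ⟨i, hi'⟩ ⟨i + 1, hi⟩ = 3 := by
    simp [CoxeterMatrix.A]
  rw [hM, pow_succ, pow_two] at h
  have h' : cs.simple ⟨i, hi'⟩ * cs.simple ⟨i + 1, hi⟩ * cs.simple ⟨i, hi'⟩ *
      (cs.simple ⟨i + 1, hi⟩ * cs.simple ⟨i, hi'⟩ * cs.simple ⟨i + 1, hi⟩) = 1 := by
    simpa only [mul_assoc] using h
  rw [eq_inv_of_mul_eq_one_left h']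
  simp [mul_assoc]

theorem length_natSimple_le (k : ℕ) : cs.length (natSimple cs k) ≤ 1 := by
  unfold natSimple
  split
  · simp
  · simp

theorem length_descProd_le (d : ℕ) : ∀ b, cs.length (descProd (natSimple cs) b d) ≤ d := by
  induction d with
  | zero => simp [descProd]
  | succ d ih =>
    exact fun b => (cs.length_mul_le _ _).trans (add_le_add (ih _) (length_natSimple_le cs b))

theorem length_le_sum_runLength (J : Finset ℕ) (m : ℕ) (hm : m ≤ n) :
    ∀ u ∈ Subgroup.closure (natSimple cs '' {j | j ∈ (J : Set ℕ) ∧ j < m}),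
      cs.length u ≤ ∑ q ∈ range (m + 1), runLength J q := by
  induction m with
  | zero => simp
  | succ m ih =>
    intro u hu
    obtain ⟨v, hv, b, d, hbd, hJ, rfl⟩ := exists_mul_descProd_of_mem_closure
      (natSimple_mul_self cs) (natSimple_comm cs) (natSimple_braid cs) hm hu
    rw [sum_range_succ]
    refine (cs.length_mul_le _ _).trans
      (add_le_add (ih (by omega) v hv) ((length_descProd_le cs d b).trans ?_))
    have : Ico b (m + 1) ⊆ {p ∈ range (m + 1) | Ico p (m + 1) ⊆ J} := by
      intro p hp
      simp only [mem_Ico, mem_filter, mem_range] at hp ⊢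
      exact ⟨hp.2, fun k hk => hJ k (by simp at hk; omega) (by simp at hk; omega)⟩
    calc d = #(Ico b (m + 1)) := by simp; omega
      _ ≤ _ := card_le_card this

theorem parabolic_eq_closure_natSimple (J : Finset (Fin n)) :
    parabolic cs (J : Set (Fin n)) = Subgroup.closure
      (natSimple cs '' {j | j ∈ ((J.map Fin.valEmbedding : Finset ℕ) : Set ℕ) ∧ j < n}) := by
  unfold parabolic
  congr 1
  ext w
  constructor
  · rintro ⟨i, hi, rfl⟩
    exact ⟨i, ⟨mem_coe.mpr (mem_map_of_mem Fin.valEmbedding (mem_coe.mp hi)), i.2⟩,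
      natSimple_val cs i⟩
  · rintro ⟨j, ⟨hj, -⟩, rfl⟩
    simp only [coe_map, Set.mem_image] at hj
    obtain ⟨i, hi, rfl⟩ := hj
    exact ⟨i, hi, (natSimple_val cs i).symm⟩

theorem length_le_rootCount {J : Finset (Fin n)} {u : W} (hu : u ∈ parabolic cs (J : Set (Fin n))) :
    cs.length u ≤ rootCount n (J.map Fin.valEmbedding) := by
  rw [parabolic_eq_closure_natSimple] at hu
  exact length_le_sum_runLength cs _ n le_rfl u hu

theorem isLiftable_swap :
    (CoxeterMatrix.A n).IsLiftable fun i : Fin n => Equiv.swap (i : ℕ) (i + 1) := by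
  have adj (i : ℕ) : (Equiv.swap i (i + 1) * Equiv.swap (i + 1) (i + 1 + 1)) ^ 3 = 1 := by
    have h := Equiv.swap_mul_swap_mul_swap (x := i + 1 + 1) (y := i + 1) (z := i)
      (by omega) (by omega)
    have h' := Equiv.swap_mul_swap_mul_swap (x := i) (y := i + 1) (z := i + 1 + 1)
      (by omega) (by omega)
    rw [Equiv.swap_comm (i + 1 + 1) (i + 1), Equiv.swap_comm (i + 1) i] at h
    rw [Equiv.swap_comm (i + 1 + 1) i] at h'
    simp only [pow_succ, pow_zero, one_mul]
    calc _ = (Equiv.swap i (i + 1) * Equiv.swap (i + 1) (i + 1 + 1) * Equiv.swap i (i + 1)) *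
        (Equiv.swap (i + 1) (i + 1 + 1) * Equiv.swap i (i + 1) *
          Equiv.swap (i + 1) (i + 1 + 1)) := by simp only [mul_assoc]
      _ = 1 := by
        rw [h, h', Equiv.swap_mul_self]
  have comm (i j : ℕ) (h : i + 1 < j) :
      Commute (Equiv.swap i (i + 1)) (Equiv.swap j (j + 1)) := by
    apply Equiv.Perm.Disjoint.commute
    intro x
    rcases lt_or_ge x j with hx | hx
    · exact Or.inr (Equiv.swap_apply_of_ne_of_ne (by omega) (by omega))
    · exact Or.inl (Equiv.swap_apply_of_ne_of_ne (by omega) (by omega))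
  intro i j
  simp only [CoxeterMatrix.A, Matrix.of_apply]
  split_ifs with h1 h2
  · simp [h1]
  · rcases h2 with h2 | h2
    · rw [← h2, ← inv_inj, ← inv_pow]
      simpa using adj j
    · rw [← h2]
      exact adj i
  · have hne : (i : ℕ) ≠ j := fun h => h1 (Fin.ext h)
    have hc : Commute (Equiv.swap (i : ℕ) (i + 1)) (Equiv.swap (j : ℕ) (j + 1)) := by
      rcases lt_or_gt_of_ne hne with h | h
      · exact comm i j (by omega)
      · exact (comm j i (by omega)).symm
    rw [hc.mul_pow]
    simp [pow_two]

/-- The action of the Coxeter group of type `Aₙ` on `ℕ` by permutations. -/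
noncomputable def toPerm : W →* Equiv.Perm ℕ :=
  cs.lift ⟨_, isLiftable_swap⟩

theorem toPerm_simple (i : Fin n) : toPerm cs (cs.simple i) = Equiv.swap (i : ℕ) (i + 1) :=
  cs.lift_apply_simple isLiftable_swap i

/-- The inversions of a permutation of `ℕ`. -/
def inversions (w : Equiv.Perm ℕ) : Set (ℕ × ℕ) :=
  {x | x.1 < x.2 ∧ w x.2 < w x.1}

theorem inversions_swap_mul_subset (w : Equiv.Perm ℕ) (i : ℕ) :
    inversions (Equiv.swap i (i + 1) * w) ⊆
      insert (w⁻¹ i, w⁻¹ (i + 1)) (inversions w) := by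
  rintro ⟨p, q⟩ ⟨hpq, h⟩
  simp only [Equiv.Perm.mul_apply, Equiv.swap_apply_def] at hpq h
  have hne : w p ≠ w q := fun e => hpq.ne (w.injective e)
  by_cases hi : w p = i ∧ w q = i + 1
  · left
    rw [← hi.2, ← hi.1]
    simp
  · right
    refine ⟨hpq, ?_⟩
    simp only
    split_ifs at h <;> omega

theorem inversions_subset_swap_mul (w : Equiv.Perm ℕ) (i : ℕ) (hi : w⁻¹ i < w⁻¹ (i + 1)) :
    insert (w⁻¹ i, w⁻¹ (i + 1)) (inversions w) ⊆ inversions (Equiv.swap i (i + 1) * w) := by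
  rintro ⟨p, q⟩ (h | ⟨hpq, h⟩)
  · simp only [Prod.mk.injEq] at h
    obtain ⟨rfl, rfl⟩ := h
    exact ⟨hi, by simp⟩
  · refine ⟨hpq, ?_⟩
    simp only [Equiv.Perm.mul_apply, Equiv.swap_apply_def] at hpq h ⊢
    have : ¬ (w q = i ∧ w p = i + 1) := by
      rintro ⟨h1, h2⟩
      rw [← h2, ← h1] at hi
      simp at hi
      omega
    split_ifs <;> omega

theorem inversions_wordProd (ω : List (Fin n)) :
    (inversions (toPerm cs (cs.wordProd ω))).Finite ∧
      (inversions (toPerm cs (cs.wordProd ω))).ncard ≤ ω.length := by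
  induction ω with
  | nil =>
    have : inversions 1 = ∅ := by
      ext x
      simp only [inversions, Set.mem_ofPred_eq, Equiv.Perm.one_apply, Set.mem_empty_iff_false, iff_false]
      exact fun h => h.1.not_gt h.2
    simp [this]
  | cons i ω ih =>
    rw [cs.wordProd_cons, map_mul, toPerm_simple]
    have hsub := inversions_swap_mul_subset (toPerm cs (cs.wordProd ω)) i
    have hfin := ih.1.insert ((toPerm cs (cs.wordProd ω))⁻¹ i, (toPerm cs (cs.wordProd ω))⁻¹ (i + 1))
    exact ⟨hfin.subset hsub, (Set.ncard_le_ncard hsub hfin).trans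
      ((Set.ncard_insert_le _ _).trans (Nat.add_le_add_right ih.2 1))⟩

theorem finite_inversions (w : W) : (inversions (toPerm cs w)).Finite := by
  obtain ⟨ω, -, rfl⟩ := cs.exists_isReduced w
  exact (inversions_wordProd cs ω).1

theorem ncard_inversions_le_length (w : W) :
    (inversions (toPerm cs w)).ncard ≤ cs.length w := by
  obtain ⟨ω, hω, rfl⟩ := cs.exists_isReduced w
  exact (inversions_wordProd cs ω).2.trans hω.eq.ge

theorem rootCount_eq_card (J : Finset ℕ) :
    rootCount n J = #((range (n + 1)).sigma fun q => {p ∈ range q | Ico p q ⊆ J}) := by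
  rw [card_sigma]
  rfl

theorem exists_rootCount_le_length (J : Finset (Fin n)) :
    ∃ w ∈ parabolic cs (J : Set (Fin n)), rootCount n (J.map Fin.valEmbedding) ≤ cs.length w := by
  classical
  have hbdd : ∀ k, (∃ w ∈ parabolic cs (J : Set (Fin n)), (inversions (toPerm cs w)).ncard = k) →
      k ≤ rootCount n (J.map Fin.valEmbedding) := by
    rintro _ ⟨w, hw, rfl⟩
    exact (ncard_inversions_le_length cs w).trans (length_le_rootCount cs hw)
  obtain ⟨w, hw, hwk⟩ := Nat.findGreatest_spec
    (P := fun k => ∃ w ∈ parabolic cs (J : Set (Fin n)), (inversions (toPerm cs w)).ncard = k)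
    (hbdd _ ⟨1, one_mem _, rfl⟩) ⟨1, one_mem _, rfl⟩
  have hmax : ∀ u ∈ parabolic cs (J : Set (Fin n)),
      (inversions (toPerm cs u)).ncard ≤ (inversions (toPerm cs w)).ncard := by
    intro u hu
    rw [hwk]
    exact Nat.le_findGreatest (hbdd _ ⟨u, hu, rfl⟩) ⟨u, hu, rfl⟩
  have hdesc : ∀ i ∈ J, (toPerm cs w)⁻¹ ((i : ℕ) + 1) < (toPerm cs w)⁻¹ i := by
    intro i hi
    by_contra! hle
    have hlt := hle.lt_of_ne fun h => by simpa using (toPerm cs w)⁻¹.injective h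
    have hsub := inversions_subset_swap_mul (toPerm cs w) i hlt
    have h := hmax (cs.simple i * w) (mul_mem (Subgroup.subset_closure ⟨i, hi, rfl⟩) hw)
    have hfin := finite_inversions cs (cs.simple i * w)
    rw [map_mul, toPerm_simple] at h hfin
    have h' := Set.ncard_le_ncard hsub hfin
    rw [Set.ncard_insert_of_notMem (by simp [inversions]) (finite_inversions cs w)] at h'
    omega
  have hchain : ∀ p q, p < q → Ico p q ⊆ J.map Fin.valEmbedding →
      (toPerm cs w)⁻¹ q < (toPerm cs w)⁻¹ p := by
    intro p q hpq
    induction q, hpq using Nat.le_induction with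
    | base =>
      intro h
      obtain ⟨i, hi, rfl⟩ := mem_map.mp (h (by simp : p ∈ Ico p (p + 1)))
      exact hdesc i hi
    | succ q hq ih =>
      intro h
      obtain ⟨i, hi, hiq⟩ := mem_map.mp (h (mem_Ico.mpr ⟨by omega, by omega⟩ : q ∈ Ico p (q + 1)))
      simp only [Fin.valEmbedding_apply] at hiq
      subst hiq
      exact (hdesc i hi).trans (ih ((Ico_subset_Ico_right (by omega)).trans h))
  refine ⟨w⁻¹, inv_mem hw, le_trans ?_ (ncard_inversions_le_length cs _)⟩
  rw [rootCount_eq_card, ← Set.ncard_coe_finset]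
  refine Set.ncard_le_ncard_of_injOn (fun x => (x.2, x.1)) ?_ ?_ (finite_inversions cs _)
  · rintro ⟨q, p⟩ h
    simp only [coe_sigma, Set.mem_sigma_iff, coe_filter, Set.mem_ofPred_eq, mem_range] at h
    simp only [map_inv]
    exact ⟨h.2.1, hchain p q h.2.1 h.2.2⟩
  · rintro ⟨q, p⟩ - ⟨q', p'⟩ - h
    simp only [Prod.mk.injEq] at h
    obtain ⟨rfl, rfl⟩ := h
    rfl

theorem length_w0_eq_rootCount (J : Finset (Fin n)) :
    cs.length (w0 cs (J : Set (Fin n))) = rootCount n (J.map Fin.valEmbedding) := by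
  obtain ⟨w, hw, hwJ⟩ := exists_rootCount_le_length cs J
  have h : ∃ w ∈ parabolic cs (J : Set (Fin n)), ∀ u ∈ parabolic cs (J : Set (Fin n)),
      cs.length u ≤ cs.length w := ⟨w, hw, fun u hu => (length_le_rootCount cs hu).trans hwJ⟩
  rw [w0, dif_pos h]
  exact le_antisymm (length_le_rootCount cs h.choose_spec.1)
    (hwJ.trans (h.choose_spec.2 w hw))

end TypeA

theorem lenA_eq_rootCount (n : ℕ) (J : Finset (Fin n)) :
    lenA n J = rootCount n (J.map Fin.valEmbedding) :=
  length_w0_eq_rootCount (CoxeterMatrix.A n).toCoxeterSystem J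

theorem rootCount_union_Ico {n : ℕ} {J : Finset ℕ} (hJ : J ⊆ range n) (d : ℕ) :
    rootCount (n + 1 + d) (J ∪ Ico (n + 1) (n + 1 + d)) = rootCount n J + (d + 1).choose 2 := by
  rw [rootCount, show n + 1 + d + 1 = n + 1 + (d + 1) by ring, sum_range_add, rootCount]
  congr 1
  · refine sum_congr rfl fun q hq => ?_
    rw [mem_range] at hq
    unfold runLength
    congr 1
    refine filter_congr fun p _ => forall₂_congr fun k hk => ?_
    simp only [mem_Ico, mem_union] at hk ⊢
    constructor
    · rintro (h | h)
      · exact h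
      · omega
    · exact Or.inl
  · rw [Nat.choose_two_right, ← sum_range_id]
    refine sum_congr rfl fun e he => ?_
    rw [mem_range] at he
    have : {p ∈ range (n + 1 + e) | Ico p (n + 1 + e) ⊆ J ∪ Ico (n + 1) (n + 1 + d)} =
        Ico (n + 1) (n + 1 + e) := by
      ext p
      simp only [mem_filter, mem_range, mem_Ico]
      constructor
      · rintro ⟨h1, h2⟩
        refine ⟨?_, h1⟩
        by_contra! hp
        have h := h2 (mem_Ico.mpr ⟨Nat.lt_succ_iff.mp hp, by omega⟩ : n ∈ Ico p (n + 1 + e))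
        simp only [mem_union, mem_Ico] at h
        rcases h with h | h
        · simpa using hJ h
        · omega
      · rintro ⟨h1, h2⟩
        refine ⟨h2, fun k hk => mem_union_right _ ?_⟩
        simp only [mem_Ico] at hk ⊢
        omega
    rw [runLength, this, Nat.card_Ico]
    omega

theorem rootCount_range (n : ℕ) : rootCount n (range n) = (n + 1).choose 2 := by
  rw [Nat.choose_two_right, ← sum_range_id, rootCount]
  refine sum_congr rfl fun q hq => ?_
  rw [mem_range] at hq
  rw [runLength, filter_true_of_mem, card_range]
  intro p _ k hk
  simp only [mem_Ico, mem_range] at hk ⊢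
  omega

/-- The monomial recording the size and the number of positive roots of `J ⊆ {0, …, n - 1}`. -/
noncomputable def weight (n : ℕ) (J : Finset ℕ) : Polynomial (Polynomial ℤ) :=
  yv ^ #J * zv ^ rootCount n J

theorem weight_union_Ico {n : ℕ} {J : Finset ℕ} (hJ : J ⊆ range n) (d : ℕ) :
    weight (n + 1 + d) (J ∪ Ico (n + 1) (n + 1 + d)) =
      weight n J * (yv ^ d * zv ^ (d + 1).choose 2) := by
  have hdisj : Disjoint J (Ico (n + 1) (n + 1 + d)) := by
    rw [disjoint_left]
    intro k hk
    have := mem_range.mp (hJ hk)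
    simp only [mem_Ico]
    omega
  rw [weight, weight, rootCount_union_Ico hJ, card_union_of_disjoint hdisj, Nat.card_Ico,
    Nat.add_sub_cancel_left]
  ring

theorem weight_range (n : ℕ) : weight n (range n) = yv ^ n * zv ^ (n + 1).choose 2 := by
  rw [weight, rootCount_range, card_range]

theorem sum_weight_union_Ico (n : ℕ) : ∀ d,
    ∑ J ∈ (range n).powerset, weight (n + d) (J ∪ Ico n (n + d)) =
      yv ^ (n + d) * zv ^ (n + d + 1).choose 2 +
        ∑ i ∈ range n, (∑ J ∈ (range i).powerset, weight i J) *
          (yv ^ (n - 1 - i + d) * zv ^ (n - 1 - i + d + 1).choose 2) := by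
  induction n with
  | zero =>
    intro d
    rw [← weight_range]
    simp
  | succ n ih =>
    intro d
    have h1 : ∑ J ∈ (range n).powerset, weight (n + 1 + d) (J ∪ Ico (n + 1) (n + 1 + d)) =
        (∑ J ∈ (range n).powerset, weight n J) * (yv ^ d * zv ^ (d + 1).choose 2) := by
      rw [sum_mul]
      exact sum_congr rfl fun J hJ => weight_union_Ico (mem_powerset.mp hJ) d
    have h2 : ∑ J ∈ (range n).powerset,
        weight (n + 1 + d) (insert n J ∪ Ico (n + 1) (n + 1 + d)) =
        ∑ J ∈ (range n).powerset, weight (n + (d + 1)) (J ∪ Ico n (n + (d + 1))) := by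
      refine sum_congr rfl fun J _ => ?_
      congr 1
      · ring
      · ext k
        simp only [mem_union, mem_insert, mem_Ico]
        grind
    have h3 : ∀ i ∈ range n, (∑ J ∈ (range i).powerset, weight i J) *
        (yv ^ (n - 1 - i + (d + 1)) * zv ^ (n - 1 - i + (d + 1) + 1).choose 2) =
        (∑ J ∈ (range i).powerset, weight i J) *
        (yv ^ (n + 1 - 1 - i + d) * zv ^ (n + 1 - 1 - i + d + 1).choose 2) := by
      intro i hi
      rw [mem_range] at hi
      rw [show n - 1 - i + (d + 1) = n + 1 - 1 - i + d by omega]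
    rw [sum_range_succ, range_add_one, sum_powerset_insert notMem_range_self, h1, h2, ih,
      sum_congr rfl h3, show n + (d + 1) = n + 1 + d by ring,
      show n + 1 - 1 - n + d = d by omega]
    ring

theorem coeff_TA (n : ℕ) :
    PowerSeries.coeff n TA = ∑ J ∈ (range n).powerset, weight n J := by
  classical
  have hcount : ∀ k l, (Acount n k l : Polynomial (Polynomial ℤ)) =
      ∑ J : Finset (Fin n), if #J = k ∧ lenA n J = l then 1 else 0 := by
    intro k l
    rw [Acount, Nat.card_eq_fintype_card, Fintype.card_subtype, sum_boole]
  have hfin : ∀ (f : ℕ → Polynomial (Polynomial ℤ)) (a : ℕ), (∀ x, x ≠ a → f x = 0) →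
      f.support.Finite := fun f a hf =>
    (Set.finite_singleton a).subset fun x hx => by_contra fun h => hx (hf x h)
  have hinner : ∀ k, ∑ᶠ l, (Acount n k l : Polynomial (Polynomial ℤ)) * yv ^ k * zv ^ l =
      ∑ J : Finset (Fin n), if #J = k then yv ^ k * zv ^ lenA n J else 0 := by
    intro k
    simp_rw [hcount, sum_mul]
    have h0 : ∀ J : Finset (Fin n), ∀ l, l ≠ lenA n J →
        (if #J = k ∧ lenA n J = l then (1 : Polynomial (Polynomial ℤ)) else 0) *
          yv ^ k * zv ^ l = 0 := by
      intro J l hl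
      rw [if_neg fun h => hl h.2.symm, zero_mul, zero_mul]
    rw [finsum_sum_comm _ _ fun J _ => hfin _ _ (h0 J)]
    refine sum_congr rfl fun J _ => ?_
    rw [finsum_eq_single _ _ (h0 J)]
    simp
  have h0 : ∀ J : Finset (Fin n), ∀ k, k ≠ #J →
      (if #J = k then yv ^ k * zv ^ lenA n J else 0) = 0 := fun J k hk => if_neg hk.symm
  rw [TA, PowerSeries.coeff_mk]
  simp_rw [hinner]
  rw [finsum_sum_comm _ _ fun J _ => hfin _ _ (h0 J)]
  refine sum_bij (fun J _ => J.map Fin.valEmbedding) (fun J _ => ?_) (fun J _ K _ h => ?_)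
    (fun K hK => ?_) fun J _ => ?_
  · rw [mem_powerset]
    intro k hk
    obtain ⟨i, -, rfl⟩ := mem_map.mp hk
    exact mem_range.mpr i.2
  · exact map_injective _ h
  · rw [mem_powerset] at hK
    exact ⟨K.attachFin fun k hk => mem_range.mp (hK hk), mem_univ _, map_valEmbedding_attachFin _⟩
  · rw [finsum_eq_single _ _ (h0 J), if_pos rfl, lenA_eq_rootCount, weight, card_map]

theorem coeff_TA_eq (n : ℕ) :
    PowerSeries.coeff n TA = PowerSeries.coeff n Pser +
      ∑ i ∈ range n, PowerSeries.coeff i TA * PowerSeries.coeff (n - 1 - i) Pser := by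
  simpa [coeff_TA, Pser] using sum_weight_union_Ico n 0

/-- `T_A(x,y,z) · (1 - x·P) = P`. -/
theorem TA_mul_one_sub_xP : TA * (1 - PowerSeries.X * Pser) = Pser := by
  rw [mul_sub, mul_one, mul_left_comm, sub_eq_iff_eq_add]
  ext1 n
  rw [coeff_TA_eq, map_add]
  congr 1
  cases n with
  | zero => simp
  | succ n =>
    rw [PowerSeries.coeff_succ_X_mul, PowerSeries.coeff_mul,
      Nat.sum_antidiagonal_eq_sum_range_succ fun i j =>
        PowerSeries.coeff i TA * PowerSeries.coeff j Pser]
    simp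

end CoxeterCharPoly
end
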